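/- Let h be a hyperexponential term given in standard form h = c0·exp(a/b)·∏_{ℓ=1}^L c_ℓ^{e_ℓ} satisfying the nondegeneracy assumptions. Set d = (α+β)·(2γ−1+φ3) + γ if deg_x a > deg_x b, and d = α·(2γ−1+φ3) if deg_x a ≤ deg_x b. Then there exists a creative telescoping relation for h of degree at most d, i.e. there exist an integer r ≥ 0, polynomials p_0, …, p_r ∈ K[x], not all zero, with deg p_i ≤ d for all i, and a rational function q ∈ K(x,y), such that p_0·h + p_1·D_x h + ⋯ + p_r·D_x^r h = D_y(q·h). -/

import Mathlib

open Polynomial Finset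

/-- The derivative with respect to `y` on `K[y][x]`
(we represent bivariate polynomials as `Polynomial (Polynomial K)`,
the *outer* variable being `x`, the *inner* variable being `y`). -/
noncomputable def DY {K : Type*} [CommRing K] (p : Polynomial (Polynomial K)) :
    Polynomial (Polynomial K) :=
  p.sum fun n a => Polynomial.C (Polynomial.derivative a) * Polynomial.X ^ n

/-- The degree with respect to `y` of an element of `K[y][x]`. -/
noncomputable def degY {K : Type*} [CommRing K] (p : Polynomial (Polynomial K)) : ℕ :=
  p.support.sup fun n => (p.coeff n).natDegree

/-- The embedding of `K[x]` into `K[y][x]` (polynomials free of `y`). -/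
noncomputable def liftX {K : Type*} [CommRing K] (p : Polynomial K) :
    Polynomial (Polynomial K) :=
  p.map (Polynomial.C : K →+* Polynomial K)

/-- The falling factorial `z(z-1)⋯(z-n+1)` of an element of `K`. -/
noncomputable def ffall {K : Type*} [Field K] (z : K) (n : ℕ) : K :=
  ∏ j ∈ Finset.range n, (z - (j : K))

/-- Derivations of a commutative ring into itself. -/
abbrev SelfDerivation (R : Type*) [CommRing R] := Derivation ℤ R R

section BivariateDegrees

open Polynomial.Bivariate

section CommRing

variable {K : Type*} [CommRing K]

lemma coeff_swap (p : K[X][X]) (i j : ℕ) :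
    ((swap p).coeff i).coeff j = (p.coeff j).coeff i := by
  induction p using Polynomial.induction_on' with
  | add p q hp hq => simp [hp, hq]
  | monomial n f =>
    rw [swap_monomial, coeff_mul_C, coeff_map, coeff_C_mul, coeff_X_pow, coeff_monomial]
    by_cases h : n = j
    · subst h; simp
    · rw [if_neg h, if_neg (Ne.symm h)]; simp

lemma coeff_DY (p : K[X][X]) (n : ℕ) : (DY p).coeff n = derivative (p.coeff n) := by
  rw [DY, Polynomial.sum, finsetSum_coeff]
  simp only [coeff_C_mul, coeff_X_pow, mul_ite, mul_one, mul_zero]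
  rw [Finset.sum_ite_eq]
  split_ifs with h
  · rfl
  · rw [notMem_support_iff.mp h, derivative_zero]

lemma DY_eq_swap (p : K[X][X]) : DY p = swap (derivative (swap p)) := by
  ext i j
  rw [coeff_swap, coeff_DY, coeff_derivative, coeff_derivative]
  have : (((j : K[X]) + 1)) = C ((j : K) + 1) := by simp
  rw [this, coeff_mul_C, coeff_swap]

lemma degY_le_iff (p : K[X][X]) (n : ℕ) :
    degY p ≤ n ↔ ∀ i j, n < j → (p.coeff i).coeff j = 0 := by
  rw [degY, Finset.sup_le_iff]
  constructor
  · intro h i j hj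
    by_cases hi : i ∈ p.support
    · exact coeff_eq_zero_of_natDegree_lt ((h i hi).trans_lt hj)
    · rw [notMem_support_iff.mp hi, coeff_zero]
  · intro h i _
    exact natDegree_le_iff_coeff_eq_zero.mpr fun j hj => h i j hj

lemma degY_eq_natDegree_swap (p : K[X][X]) : degY p = (swap p).natDegree := by
  refine le_antisymm ?_ ?_
  · rw [degY_le_iff]
    intro i j hj
    rw [← coeff_swap, coeff_eq_zero_of_natDegree_lt hj, coeff_zero]
  · rw [natDegree_le_iff_coeff_eq_zero]
    intro j hj
    ext i
    rw [coeff_swap, (degY_le_iff p _).mp le_rfl i j hj, coeff_zero]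

lemma degY_add_le (p q : K[X][X]) : degY (p + q) ≤ max (degY p) (degY q) := by
  simp only [degY_eq_natDegree_swap, map_add]
  exact natDegree_add_le _ _

lemma degY_sub_le (p q : K[X][X]) : degY (p - q) ≤ max (degY p) (degY q) := by
  simp only [degY_eq_natDegree_swap, map_sub]
  exact natDegree_sub_le _ _

lemma degY_mul_le (p q : K[X][X]) : degY (p * q) ≤ degY p + degY q := by
  simp only [degY_eq_natDegree_swap, map_mul]
  exact natDegree_mul_le

lemma degY_sum_le {ι : Type*} (s : Finset ι) (f : ι → K[X][X]) (n : ℕ)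
    (h : ∀ i ∈ s, degY (f i) ≤ n) : degY (∑ i ∈ s, f i) ≤ n := by
  simp only [degY_eq_natDegree_swap, map_sum] at h ⊢
  exact natDegree_sum_le_of_forall_le _ _ h

@[simp] lemma degY_zero : degY (0 : K[X][X]) = 0 := by
  simp [degY_eq_natDegree_swap]

@[simp] lemma degY_one : degY (1 : K[X][X]) = 0 := by
  simp [degY_eq_natDegree_swap]

@[simp] lemma degY_natCast (n : ℕ) : degY (n : K[X][X]) = 0 := by
  simp [degY_eq_natDegree_swap]

@[simp] lemma degY_intCast (n : ℤ) : degY (n : K[X][X]) = 0 := by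
  simp [degY_eq_natDegree_swap]

@[simp] lemma degY_liftX (p : K[X]) : degY (liftX p) = 0 := by
  simp [degY_eq_natDegree_swap, liftX, swap_map_C]

lemma degY_derivative_le (p : K[X][X]) : degY (derivative p) ≤ degY p := by
  rw [degY_le_iff]
  intro i j hj
  have : (((i : K[X]) + 1)) = C ((i : K) + 1) := by simp
  rw [coeff_derivative, this, coeff_mul_C, (degY_le_iff p _).mp le_rfl _ _ hj, zero_mul]

lemma degY_CX_mul_DY_le (p : K[X][X]) : degY (C X * DY p) ≤ degY p := by
  rw [degY_eq_natDegree_swap, degY_eq_natDegree_swap, map_mul, swap_X, DY_eq_swap,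
    swap_swap_apply, natDegree_le_iff_coeff_eq_zero]
  intro N hN
  obtain _ | N := N
  · simp
  · rw [coeff_X_mul, coeff_derivative, coeff_eq_zero_of_natDegree_lt hN, zero_mul]

lemma natDegree_DY_le (p : K[X][X]) : (DY p).natDegree ≤ p.natDegree := by
  rw [natDegree_le_iff_coeff_eq_zero]
  intro N hN
  rw [coeff_DY, coeff_eq_zero_of_natDegree_lt hN, derivative_zero]

lemma exists_eq_liftX {p : K[X][X]} (hp : degY p = 0) : ∃ q : K[X], p = liftX q := by
  refine ⟨p.map constantCoeff, ?_⟩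
  ext i j
  rw [liftX, coeff_map, coeff_map, constantCoeff_apply, coeff_C]
  split_ifs with h
  · rw [h]
  · exact (degY_le_iff p 0).mp hp.le i j (Nat.pos_of_ne_zero h)

/-- Partial differentiation with respect to `y` as a derivation of `K[y][x]`. -/
noncomputable def derivY : SelfDerivation K[X][X] :=
  Derivation.mk' (AddMonoidHom.mk' (DY : K[X][X] → K[X][X])
    (fun p q => by simp [DY_eq_swap])).toIntLinearMap
    (fun p q => by
      simp only [AddMonoidHom.coe_toIntLinearMap, AddMonoidHom.mk'_apply, DY_eq_swap, map_mul,
        derivative_mul, map_add, swap_swap_apply, smul_eq_mul]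
      ring)

@[simp] lemma derivY_apply (p : K[X][X]) : derivY p = DY p := rfl

/-- Partial differentiation with respect to `x` as a derivation of `K[y][x]`. -/
noncomputable def derivX : SelfDerivation K[X][X] :=
  (derivative' : Derivation K[X] K[X][X] K[X][X]).restrictScalars ℤ

@[simp] lemma derivX_apply (p : K[X][X]) : derivX p = derivative p := rfl

end CommRing

section Domain

variable {K : Type*} [CommRing K] [IsDomain K]

lemma degY_mul {p q : K[X][X]} (hp : p ≠ 0) (hq : q ≠ 0) :
    degY (p * q) = degY p + degY q := by
  simp only [degY_eq_natDegree_swap, map_mul]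
  exact natDegree_mul (by simpa using hp) (by simpa using hq)

lemma degY_prod {ι : Type*} (s : Finset ι) (f : ι → K[X][X]) (hf : ∀ i ∈ s, f i ≠ 0) :
    degY (∏ i ∈ s, f i) = ∑ i ∈ s, degY (f i) := by
  simp only [degY_eq_natDegree_swap, map_prod]
  exact natDegree_prod _ _ fun i hi => by simpa using hf i hi

@[simp] lemma degY_CX : degY (C X : K[X][X]) = 1 := by
  simp [degY_eq_natDegree_swap, swap_X]

lemma degY_eq_zero_of_isUnit {p : K[X][X]} (hp : IsUnit p) : degY p = 0 := by
  rw [degY_eq_natDegree_swap]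
  exact natDegree_eq_zero_of_isUnit (hp.map swap)

lemma degY_le_of_CX_mul {p : K[X][X]} {n : ℕ} (h : degY (C X * p) ≤ n + 1) : degY p ≤ n := by
  by_cases hp : p = 0
  · simp [hp]
  · rw [degY_mul (by simp) hp, degY_CX] at h
    omega

lemma not_dvd_DY [CharZero K] {p : K[X][X]} (hp : 0 < degY p) : ¬ p ∣ DY p := by
  rintro ⟨k, hk⟩
  have hp0 : p ≠ 0 := by rintro rfl; simp at hp
  have hd : (swap (DY p)) = derivative (swap p) := by rw [DY_eq_swap, swap_swap_apply]
  rw [degY_eq_natDegree_swap] at hp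
  have hne : DY p ≠ 0 := by
    intro h0
    rw [h0, map_zero] at hd
    exact hp.ne' (derivative_eq_zero.mp hd.symm)
  have hlt : degY (DY p) < degY p := by
    rw [degY_eq_natDegree_swap, degY_eq_natDegree_swap, hd]
    exact natDegree_derivative_lt hp.ne'
  have hk0 : k ≠ 0 := by rintro rfl; simp [hk] at hne
  rw [hk, degY_mul hp0 hk0] at hlt
  omega

lemma eq_zero_of_dvd_intCast [CharZero K] {p : K[X][X]} (hp : 0 < degY p) (z : ℤ)
    (h : p ∣ (z : K[X][X])) : z = 0 := by
  by_contra hz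
  obtain ⟨q, hq⟩ := h
  have hz' : (z : K[X][X]) ≠ 0 := by exact_mod_cast hz
  have hpq := hq ▸ hz'
  have h1 := degY_mul (left_ne_zero_of_mul hpq) (right_ne_zero_of_mul hpq)
  rw [← hq, degY_intCast] at h1
  omega

lemma exists_prime_dvd_degY_pos [UniqueFactorizationMonoid K] {b : K[X][X]}
    (hb : 0 < degY b) : ∃ p, Prime p ∧ p ∣ b ∧ 0 < degY p := by
  induction b using UniqueFactorizationMonoid.induction_on_prime with
  | h₁ => simp at hb
  | h₂ x hx => rw [degY_eq_zero_of_isUnit hx] at hb; omega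
  | h₃ a p ha hp ih =>
    rw [degY_mul hp.ne_zero ha] at hb
    by_cases h : 0 < degY p
    · exact ⟨p, hp, dvd_mul_right _ _, h⟩
    · obtain ⟨q, hq, hqa, hq'⟩ := ih (by omega)
      exact ⟨q, hq, hqa.mul_left _, hq'⟩

lemma natDegree_eq_of_derivative_mul_eq [CharZero K] {s t : K[X]} (hs : s ≠ 0) (ht : t ≠ 0)
    (h : derivative s * t = s * derivative t) : s.natDegree = t.natDegree := by
  have key (q : K[X]) : (X * derivative q).natDegree ≤ q.natDegree ∧
      (X * derivative q).coeff q.natDegree = q.natDegree * q.leadingCoeff := by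
    constructor
    · rw [natDegree_le_iff_coeff_eq_zero]
      rintro (_ | N) hN
      · simp
      · rw [coeff_X_mul, coeff_derivative, coeff_eq_zero_of_natDegree_lt hN, zero_mul]
    · rw [leadingCoeff]
      rcases q.natDegree with _ | N
      · simp
      · rw [coeff_X_mul, coeff_derivative]; push_cast; ring
  have h1 : (X * derivative s) * t = s * (X * derivative t) := by linear_combination X * h
  have h2 := congrArg (fun q => q.coeff (s.natDegree + t.natDegree)) h1
  simp only [coeff_mul_add_eq_of_natDegree_le (key s).1 le_rfl,
    coeff_mul_add_eq_of_natDegree_le le_rfl (key t).1, (key s).2, (key t).2] at h2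
  have hs' : s.coeff s.natDegree ≠ 0 := by simpa using hs
  have ht' : t.coeff t.natDegree ≠ 0 := by simpa using ht
  have h3 : ((s.natDegree : K) - t.natDegree) * (s.coeff s.natDegree * t.coeff t.natDegree) = 0 := by
    simp only [leadingCoeff] at h2
    linear_combination h2
  have := (mul_eq_zero.mp h3).resolve_right (mul_ne_zero hs' ht')
  exact_mod_cast sub_eq_zero.mp this

lemma degY_eq_of_DY_mul_eq [CharZero K] {s t : K[X][X]} (hs : s ≠ 0) (ht : t ≠ 0)
    (h : DY s * t = s * DY t) : degY s = degY t := by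
  rw [degY_eq_natDegree_swap, degY_eq_natDegree_swap]
  refine natDegree_eq_of_derivative_mul_eq (by simpa using hs) (by simpa using ht) ?_
  have := congrArg swap h
  simpa only [map_mul, DY_eq_swap, swap_swap_apply] using this

end Domain

end BivariateDegrees

section DerivationNumerators

/-- If `δ H / H = v / w`, then `derivNum δ w v n Q` is the numerator of
`δ (Q * H / w ^ n)` over `w ^ (n + 1)`, relative to `H`. -/
def derivNum {R : Type*} [CommRing R] (δ : SelfDerivation R) (w v : R) (n : ℕ) (Q : R) : R :=
  w * δ Q - n * (Q * δ w) + Q * v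

variable {R : Type*} [CommRing R]

lemma mul_derivation_pow (δ : SelfDerivation R) (p : R) (n : ℕ) :
    p * δ (p ^ n) = n * p ^ n * δ p := by
  rw [Derivation.leibniz_pow]
  obtain _ | n := n
  · simp
  · simp only [nsmul_eq_mul, smul_eq_mul, Nat.add_sub_cancel]
    ring

lemma derivation_mul_div_pow {E : Type*} [Field E] (D : SelfDerivation E) (δ : SelfDerivation R)
    (ι : R →+* E) (hι : ∀ q, D (ι q) = ι (δ q)) {w v : R} {H : E} (hw : ι w ≠ 0)
    (hH : D H * ι w = H * ι v) (n : ℕ) (Q : R) :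
    D (ι Q * H / ι w ^ n) = ι (derivNum δ w v n Q) * H / ι w ^ (n + 1) := by
  have hpow := mul_derivation_pow D (ι w) n
  rw [Derivation.leibniz_div, eq_div_iff (pow_ne_zero _ hw)]
  have hwn : ι w ^ n ≠ 0 := pow_ne_zero _ hw
  simp only [smul_eq_mul, Derivation.leibniz, hι, derivNum, map_add, map_sub, map_mul,
    map_natCast] at hpow ⊢
  field_simp
  rw [pow_succ]
  linear_combination (ι w ^ n * ι w ^ n * ι Q) * hH - (ι w ^ n * ι Q * H) * hpow

lemma derivNum_wronskian [IsDomain R] {δ : SelfDerivation R} {w v : R} {n : ℕ} {S T : R}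
    (hw : w ≠ 0) (hS : derivNum δ w v n S = 0) (hT : derivNum δ w v n T = 0) :
    δ S * T = S * δ T := by
  refine mul_left_cancel₀ hw ?_
  simp only [derivNum] at hS hT
  linear_combination T * hS - S * hT

lemma derivNum_mul_self {δ : SelfDerivation R} {w v : R} {n : ℕ} {Q : R} :
    derivNum δ w v (n + 1) (Q * w) = w * derivNum δ w v n Q := by
  simp only [derivNum, Derivation.leibniz, smul_eq_mul]
  push_cast
  ring

lemma dvd_of_pow_dvd_derivNum [IsDomain R] (δ : SelfDerivation R) {p w Q v : R} (hp : Prime p)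
    (hQ : ¬ p ∣ Q) {j k n : ℕ}
    (h : p ^ (j + (k + 1)) ∣ derivNum δ (p ^ (k + 1) * w) v n (p ^ j * Q)) :
    p ∣ v - ((n * (k + 1) - j : ℤ) : R) * (δ p * (p ^ k * w)) := by
  have hj := mul_derivation_pow δ p j
  have hk : δ (p ^ (k + 1)) = (k + 1) * p ^ k * δ p := by
    rw [Derivation.leibniz_pow]
    simp only [nsmul_eq_mul, smul_eq_mul, Nat.add_sub_cancel]
    push_cast
    ring
  have key : p * derivNum δ (p ^ (k + 1) * w) v n (p ^ j * Q) = p ^ (j + 1) *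
      (Q * (v - ((n * (k + 1) - j : ℤ) : R) * (δ p * (p ^ k * w)))
        + p * (p ^ k * (w * δ Q - n * (Q * δ w)))) := by
    simp only [derivNum, Derivation.leibniz, smul_eq_mul, hk]
    push_cast
    linear_combination (p ^ (k + 1) * w * Q) * hj
  have h1 : p ^ (j + 1) * p ∣ p * derivNum δ (p ^ (k + 1) * w) v n (p ^ j * Q) := by
    have : p ^ (j + 1) * p ∣ p * p ^ (j + (k + 1)) := ⟨p ^ k, by ring⟩
    exact this.trans (mul_dvd_mul_left p h)
  rw [key, mul_dvd_mul_iff_left (pow_ne_zero _ hp.ne_zero),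
    dvd_add_left (dvd_mul_right _ _)] at h1
  exact (hp.dvd_or_dvd h1).resolve_left hQ

lemma pow_dvd_of_wronskian [IsDomain R] [WfDvdMonoid R] (δ : SelfDerivation R) {p : R}
    (hp : Prime p) (hδp : ¬ p ∣ δ p) (hpz : ∀ z : ℤ, p ∣ (z : R) → z = 0) {S T : R} (t : ℕ)
    (hS : S ≠ 0) (hT : ¬ p ∣ T) (h : δ S * (p ^ t * T) = S * δ (p ^ t * T)) : p ^ t ∣ S := by
  obtain ⟨s, S', hS', rfl⟩ := WfDvdMonoid.max_power_factor hS hp.irreducible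
  have hs := mul_derivation_pow δ p s
  have ht := mul_derivation_pow δ p t
  simp only [Derivation.leibniz, smul_eq_mul] at h
  have key : p ^ (s + t) * (((s - t : ℤ) : R) * (δ p * (S' * T))
      + p * (δ S' * T - S' * δ T)) = 0 := by
    push_cast
    linear_combination p * h - (S' * (p ^ t * T)) * hs + (p ^ s * S' * T) * ht
  have key' := (mul_eq_zero.mp key).resolve_left (pow_ne_zero _ hp.ne_zero)
  have hdvd : p ∣ ((s - t : ℤ) : R) * (δ p * (S' * T)) := by
    rw [← dvd_add_left (dvd_mul_right p (δ S' * T - S' * δ T)), key']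
    exact dvd_zero _
  have hst : (s : ℤ) - t = 0 := by
    refine hpz _ ((hp.dvd_or_dvd hdvd).resolve_right fun h1 => ?_)
    rcases hp.dvd_or_dvd h1 with h1 | h1
    · exact hδp h1
    · exact (hp.dvd_or_dvd h1).elim hS' hT
  have : s = t := by omega
  exact this ▸ dvd_mul_right _ _

/-- If every prime factor of `b` divides `s`, then `b` divides `s * δ b`. -/
lemma dvd_mul_derivation [IsDomain R] [UniqueFactorizationMonoid R] (δ : SelfDerivation R) {b : R}
    (hb : b ≠ 0) {s : R} (hs : ∀ q, Prime q → q ∣ b → q ∣ s) : b ∣ s * δ b := by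
  induction b using UniqueFactorizationMonoid.induction_on_prime with
  | h₁ => exact absurd rfl hb
  | h₂ x hx => exact hx.dvd
  | h₃ a p ha hp ih =>
    have h1 : a ∣ s * δ a := ih ha fun q hq hqa => hs q hq (hqa.mul_left _)
    have h2 : p ∣ s := hs p hp (dvd_mul_right _ _)
    have : s * δ (p * a) = p * (s * δ a) + s * a * δ p := by
      simp only [Derivation.leibniz, smul_eq_mul]
      ring
    rw [this]
    exact dvd_add (mul_dvd_mul_left _ h1) ((mul_dvd_mul_right h2 a).mul_right _)

end DerivationNumerators

section Telescoping

variable {K : Type*} {E : Type*} [Field K] [Field E]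

/-- `h` has a creative telescoping relation of degree at most `d`. -/
def HasTelescoper (Dx Dy : E → E) (ι : K[X][X] →+* E) (h : E) (d : ℕ) : Prop :=
  ∃ r : ℕ, ∃ p : ℕ → K[X], (∃ i ≤ r, p i ≠ 0) ∧ (∀ i ≤ r, (p i).natDegree ≤ d) ∧
    ∃ u v : K[X][X], v ≠ 0 ∧
      ∑ i ∈ Finset.range (r + 1), ι (liftX (p i)) * Dx^[i] h = Dy (ι u * h / ι v)

/-- A factorization `h = N * H` with `N` polynomial in which the logarithmic derivatives of `H`
are `u / w` and `v / w`, with degree bounds on `w`, `u`, `v`. -/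
structure TelescopingForm (Dx Dy : SelfDerivation E) (ι : K[X][X] →+* E) (h : E) (A γ ε : ℕ)
    (N w u v : K[X][X]) (H : E) : Prop where
  h_eq : h = ι N * H
  H_ne : H ≠ 0
  N_ne : N ≠ 0
  w_ne : w ≠ 0
  Dx_H : Dx H * ι w = H * ι u
  Dy_H : Dy H * ι w = H * ι v
  natDegree_w : w.natDegree ≤ A
  natDegree_u : u.natDegree ≤ A
  natDegree_v : v.natDegree ≤ A + ε
  degY_w : degY w ≤ γ
  degY_u : degY u ≤ γ
  degY_v : degY (C X * v) ≤ γ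

/-- The numerator of the `i`-th `x`-derivative of `N * H` over `w ^ i`, relative to `H`. -/
noncomputable def iterNum (N w u : K[X][X]) : ℕ → K[X][X]
  | 0 => N
  | i + 1 => derivNum derivX w u i (iterNum N w u i)

lemma natDegree_derivNum_derivX_le {w u Q : K[X][X]} {A n : ℕ} (hw : w.natDegree ≤ A)
    (hu : u.natDegree ≤ A) : (derivNum derivX w u n Q).natDegree ≤ Q.natDegree + A := by
  have h1 : (derivative Q).natDegree ≤ Q.natDegree := natDegree_derivative_le _ |>.trans (by omega)
  have h2 : (derivative w).natDegree ≤ w.natDegree := natDegree_derivative_le _ |>.trans (by omega)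
  simp only [derivNum, derivX_apply]
  refine natDegree_add_le_of_degree_le ((natDegree_sub_le_of_le ?_ ?_).trans (max_self _).le) ?_
  · exact natDegree_mul_le.trans (by omega)
  · exact natDegree_mul_le.trans (by
      rw [natDegree_natCast]
      exact (zero_add _).le.trans (natDegree_mul_le.trans (by omega)))
  · exact natDegree_mul_le.trans (by omega)

lemma degY_derivNum_derivX_le {w u Q : K[X][X]} {γ n : ℕ} (hw : degY w ≤ γ)
    (hu : degY u ≤ γ) : degY (derivNum derivX w u n Q) ≤ degY Q + γ := by
  have h1 := degY_derivative_le Q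
  have h2 := degY_derivative_le w
  have h3 := degY_mul_le w (derivative Q)
  have h4 := degY_mul_le (n : K[X][X]) (Q * derivative w)
  have h5 := degY_mul_le Q (derivative w)
  have h6 := degY_mul_le Q u
  have h7 := degY_sub_le (w * derivative Q) ((n : K[X][X]) * (Q * derivative w))
  have h8 := degY_add_le (w * derivative Q - (n : K[X][X]) * (Q * derivative w)) (Q * u)
  rw [degY_natCast] at h4
  simp only [derivNum, derivX_apply]
  omega

lemma natDegree_derivNum_derivY_le {w v Q : K[X][X]} {A n : ℕ} (hw : w.natDegree ≤ A)
    (hv : v.natDegree ≤ A) : (derivNum derivY w v n Q).natDegree ≤ Q.natDegree + A := by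
  have h1 := natDegree_DY_le Q
  have h2 := natDegree_DY_le w
  simp only [derivNum, derivY_apply]
  refine natDegree_add_le_of_degree_le ((natDegree_sub_le_of_le ?_ ?_).trans (max_self _).le) ?_
  · exact natDegree_mul_le.trans (by omega)
  · exact natDegree_mul_le.trans (by
      rw [natDegree_natCast]
      exact (zero_add _).le.trans (natDegree_mul_le.trans (by omega)))
  · exact natDegree_mul_le.trans (by omega)

lemma degY_CX_mul_derivNum_derivY_le {w v Q : K[X][X]} {γ n : ℕ} (hw : degY w ≤ γ)
    (hv : degY (C X * v) ≤ γ) : degY (C X * derivNum derivY w v n Q) ≤ degY Q + γ := by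
  have h1 := degY_CX_mul_DY_le Q
  have h2 := degY_CX_mul_DY_le w
  have h3 := degY_mul_le w (C X * DY Q)
  have h4 := degY_mul_le (n : K[X][X]) (Q * (C X * DY w))
  have h5 := degY_mul_le Q (C X * DY w)
  have h6 := degY_mul_le Q (C X * v)
  have h7 := degY_sub_le (w * (C X * DY Q)) ((n : K[X][X]) * (Q * (C X * DY w)))
  have h8 := degY_add_le (w * (C X * DY Q) - (n : K[X][X]) * (Q * (C X * DY w))) (Q * (C X * v))
  rw [degY_natCast] at h4
  have : C X * derivNum derivY w v n Q =
      w * (C X * DY Q) - (n : K[X][X]) * (Q * (C X * DY w)) + Q * (C X * v) := by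
    simp only [derivNum, derivY_apply]
    ring
  rw [this]
  omega

lemma natDegree_iterNum_le {N w u : K[X][X]} {A : ℕ} (hw : w.natDegree ≤ A)
    (hu : u.natDegree ≤ A) (i : ℕ) : (iterNum N w u i).natDegree ≤ N.natDegree + i * A := by
  induction i with
  | zero => simp [iterNum]
  | succ i ih =>
    refine (natDegree_derivNum_derivX_le hw hu).trans ?_
    rw [add_mul]
    omega

lemma degY_iterNum_le {N w u : K[X][X]} {γ : ℕ} (hw : degY w ≤ γ)
    (hu : degY u ≤ γ) (i : ℕ) : degY (iterNum N w u i) ≤ degY N + i * γ := by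
  induction i with
  | zero => simp [iterNum]
  | succ i ih =>
    refine (degY_derivNum_derivX_le hw hu).trans ?_
    rw [add_mul]
    omega

lemma degY_pow_le (w : K[X][X]) (n : ℕ) : degY (w ^ n) ≤ n * degY w := by
  induction n with
  | zero => simp
  | succ n ih =>
    rw [pow_succ, add_mul]
    have := degY_mul_le (w ^ n) w
    omega

namespace TelescopingForm

variable {Dx Dy : SelfDerivation E} {ι : K[X][X] →+* E} {h : E} {A γ ε : ℕ}
  {N w u v : K[X][X]} {H : E}

lemma iterate_Dx (F : TelescopingForm Dx Dy ι h A γ ε N w u v H) (hinj : Function.Injective ι)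
    (hDxι : ∀ q : K[X][X], Dx (ι q) = ι (derivative q)) (i : ℕ) :
    Dx^[i] h = ι (iterNum N w u i) * H / ι w ^ i := by
  have hw : ι w ≠ 0 := (map_ne_zero_iff ι hinj).mpr F.w_ne
  induction i with
  | zero => simp [iterNum, F.h_eq]
  | succ i ih =>
    rw [Function.iterate_succ_apply', ih,
      derivation_mul_div_pow Dx derivX ι hDxι hw F.Dx_H, iterNum]

end TelescopingForm

/-- The polynomial `∑ q i j x ^ i y ^ j` with exponents `i < m` and `j ∈ J`. -/
noncomputable def ofCoeffs (m : ℕ) (J : Finset ℕ) : (Fin m × J → K) →ₗ[K] K[X][X] where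
  toFun q := ∑ ij : Fin m × J, monomial (ij.1 : ℕ) (monomial (ij.2 : ℕ) (q ij))
  map_add' q q' := by simp [Finset.sum_add_distrib]
  map_smul' z q := by simp [Finset.smul_sum, smul_monomial]

lemma coeff_ofCoeffs {m : ℕ} {J : Finset ℕ} (q : Fin m × J → K) (ij : Fin m × J) :
    ((ofCoeffs m J q).coeff ij.1).coeff ij.2 = q ij := by
  simp only [ofCoeffs, LinearMap.coe_mk, AddHom.coe_mk, finsetSum_coeff]
  rw [Finset.sum_eq_single ij]
  · simp
  · rintro ⟨i, j⟩ - hne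
    rw [coeff_monomial]
    split_ifs with h
    · rw [coeff_monomial, if_neg]
      intro h'
      exact hne (Prod.ext (Fin.ext h) (Subtype.ext h'))
    · simp
  · simp

lemma coeff_ofCoeffs_of_notMem {m : ℕ} {J : Finset ℕ} (q : Fin m × J → K) {i j : ℕ}
    (hij : m ≤ i ∨ j ∉ J) : ((ofCoeffs m J q).coeff i).coeff j = 0 := by
  simp only [ofCoeffs, LinearMap.coe_mk, AddHom.coe_mk, finsetSum_coeff]
  refine Finset.sum_eq_zero ?_
  rintro ⟨⟨i', hi'⟩, ⟨j', hjJ⟩⟩ -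
  rw [coeff_monomial]
  split_ifs with h
  · rw [coeff_monomial, if_neg]
    simp only at h ⊢
    rintro rfl
    rcases hij with hij | hij
    · omega
    · exact hij hjJ
  · simp

/-- `Q ↦ derivNum derivY w v n Q` as a `K`-linear map. -/
noncomputable def derivNumY (w v : K[X][X]) (n : ℕ) : K[X][X] →ₗ[K] K[X][X] where
  toFun := derivNum derivY w v n
  map_add' p q := by simp only [derivNum, map_add]; ring
  map_smul' z q := by
    have : derivY (z • q) = z • derivY q := by
      ext i j
      simp [coeff_DY]
    simp only [derivNum, this, RingHom.id_apply, smul_add, smul_sub, mul_smul_comm, smul_mul_assoc]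

/-- `liftX` as a linear map. -/
noncomputable def liftXLinear : K[X] →ₗ[K] K[X][X] where
  toFun := liftX
  map_add' p q := by simp [liftX]
  map_smul' z q := by
    ext i j
    simp [liftX]

lemma natDegree_liftX_le (p : K[X]) : (liftX p).natDegree ≤ p.natDegree := natDegree_map_le

namespace TelescopingForm

variable {Dx Dy : SelfDerivation E} {ι : K[X][X] →+* E} {h : E} {A γ ε : ℕ}
  {N w u v : K[X][X]} {H : E}

/-- Linear algebra over `K`: an ansatz with more unknowns than equations yields a telescoper,
provided the admissible certificates contain no nonzero constant of `Dy`. -/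
theorem hasTelescoper_of_card (F : TelescopingForm Dx Dy ι h A γ ε N w u v H)
    (hinj : Function.Injective ι)
    (hDxι : ∀ q : K[X][X], Dx (ι q) = ι (derivative q))
    (hDyι : ∀ q : K[X][X], Dy (ι q) = ι (DY q)) {D n m : ℕ} {J : Finset ℕ}
    (hJ : ∀ j ∈ J, j ≤ degY N + n * γ + 1)
    (hm : m + ε = D + N.natDegree + n * A)
    (hker : ∀ Q : K[X][X], (∀ i j, j ∉ J → (Q.coeff i).coeff j = 0) →
      derivNum derivY w v n Q = 0 → Q = 0)
    (hcard : (D + N.natDegree + (n + 1) * A + 1) * (degY N + (n + 1) * γ + 1) <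
      (n + 2) * (D + 1) + (m + 1) * J.card) :
    HasTelescoper Dx Dy ι h D := by
  let poly : (Fin (n + 2) → degreeLT K (D + 1)) × (Fin (m + 1) × J → K) →ₗ[K] K[X][X] :=
    (∑ i : Fin (n + 2), (LinearMap.mulRight K (iterNum N w u i * w ^ (n + 1 - (i : ℕ)))) ∘ₗ
      liftXLinear ∘ₗ (degreeLT K (D + 1)).subtype ∘ₗ LinearMap.proj i ∘ₗ LinearMap.fst K _ _)
    - derivNumY w v n ∘ₗ ofCoeffs (m + 1) J ∘ₗ LinearMap.snd K _ _
  have poly_apply (p q) : poly (p, q) = ∑ i : Fin (n + 2),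
      liftX (p i : K[X]) * (iterNum N w u i * w ^ (n + 1 - (i : ℕ)))
      - derivNum derivY w v n (ofCoeffs (m + 1) J q) := by
    simp only [poly, LinearMap.sub_apply, LinearMap.sum_apply]
    rfl
  let coeffs : K[X][X] →ₗ[K] (Fin (D + N.natDegree + (n + 1) * A + 1) ×
      Fin (degY N + (n + 1) * γ + 1) → K) :=
    LinearMap.pi fun ij => lcoeff K ij.2 ∘ₗ (lcoeff K[X] ij.1).restrictScalars K
  have coeffs_apply (q ij) : coeffs q ij = (q.coeff ij.1).coeff ij.2 := rfl
  have hbot : LinearMap.ker (coeffs ∘ₗ poly) ≠ ⊥ := by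
    refine LinearMap.ker_ne_bot_of_finrank_lt ?_
    have e : Module.finrank K (degreeLT K (D + 1)) = D + 1 := by
      rw [(degreeLTEquiv K (D + 1)).finrank_eq, Module.finrank_fin_fun]
    have : Module.Finite K (degreeLT K (D + 1)) :=
      Module.Finite.equiv (degreeLTEquiv K (D + 1)).symm
    rw [Module.finrank_prod, Module.finrank_fintype_fun_eq_card,
      Module.finrank_fintype_fun_eq_card, Module.finrank_pi_fintype]
    simpa [e] using hcard
  obtain ⟨⟨p, q⟩, hpq, hne⟩ := Submodule.exists_mem_ne_zero_of_ne_bot hbot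
  have hpdeg (i) : (p i : K[X]).natDegree ≤ D := by
    have := mem_degreeLT.mp (p i).2
    exact natDegree_le_of_degree_le (Order.lt_succ_iff.mp (by exact_mod_cast this))
  set Q := ofCoeffs (m + 1) J q with hQ
  have hQx : Q.natDegree ≤ m := by
    rw [natDegree_le_iff_coeff_eq_zero]
    intro i hi
    ext j
    exact coeff_ofCoeffs_of_notMem q (Or.inl hi)
  have hQy : degY Q ≤ degY N + n * γ + 1 := by
    rw [degY_le_iff]
    intro i j hj
    exact coeff_ofCoeffs_of_notMem q (Or.inr fun hjJ => by have := hJ j hjJ; omega)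
  have hx : (poly (p, q)).natDegree ≤ D + N.natDegree + (n + 1) * A := by
    rw [poly_apply]
    refine (natDegree_sub_le_of_le ?_ ?_).trans (max_self _).le
    · refine natDegree_sum_le_of_forall_le _ _ fun i _ => ?_
      have h1 := natDegree_liftX_le (p i : K[X])
      have h2 := natDegree_iterNum_le (N := N) F.natDegree_w F.natDegree_u i
      have h3 : (w ^ (n + 1 - (i : ℕ))).natDegree ≤ (n + 1 - (i : ℕ)) * A :=
        natDegree_pow_le_of_le _ F.natDegree_w
      have h4 := hpdeg i
      have h5 : (i : ℕ) * A + (n + 1 - (i : ℕ)) * A = (n + 1) * A := by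
        rw [← add_mul]; congr 1; omega
      exact natDegree_mul_le.trans (by
        have := natDegree_mul_le (p := iterNum N w u i) (q := w ^ (n + 1 - (i : ℕ)))
        omega)
    · rw [← hQ]
      have := natDegree_derivNum_derivY_le (n := n) (Q := Q)
        (F.natDegree_w.trans (Nat.le_add_right A ε)) F.natDegree_v
      rw [add_mul]
      omega
  have hy : degY (poly (p, q)) ≤ degY N + (n + 1) * γ := by
    rw [poly_apply]
    refine (degY_sub_le _ _).trans (max_le ?_ ?_)
    · refine degY_sum_le _ _ _ fun i _ => ?_
      have h1 := degY_mul_le (liftX (p i : K[X])) (iterNum N w u i * w ^ (n + 1 - (i : ℕ)))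
      rw [degY_liftX] at h1
      have h2 := degY_iterNum_le (N := N) F.degY_w F.degY_u i
      have h3 : degY (w ^ (n + 1 - (i : ℕ))) ≤ (n + 1 - (i : ℕ)) * γ :=
        (degY_pow_le _ _).trans (Nat.mul_le_mul_left _ F.degY_w)
      have h5 : (i : ℕ) * γ + (n + 1 - (i : ℕ)) * γ = (n + 1) * γ := by
        rw [← add_mul]; congr 1; omega
      have h6 := degY_mul_le (iterNum N w u i) (w ^ (n + 1 - (i : ℕ)))
      omega
    · rw [← hQ]
      refine degY_le_of_CX_mul ?_
      have := degY_CX_mul_derivNum_derivY_le (n := n) (Q := Q) F.degY_w F.degY_v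
      rw [add_mul]
      omega
  have hzero : poly (p, q) = 0 := by
    ext i j
    rw [coeff_zero, coeff_zero]
    by_cases hi : i < D + N.natDegree + (n + 1) * A + 1
    · by_cases hj : j < degY N + (n + 1) * γ + 1
      · have := congrFun (LinearMap.mem_ker.mp hpq) (⟨i, hi⟩, ⟨j, hj⟩)
        simpa [coeffs_apply] using this
      · exact (degY_le_iff _ _).mp hy i j (by omega)
    · rw [coeff_eq_zero_of_natDegree_lt (n := i) (by omega), coeff_zero]
  rw [poly_apply, sub_eq_zero] at hzero
  have hp : ∃ i, (p i : K[X]) ≠ 0 := by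
    by_contra! hall
    have hQ0 : Q = 0 := by
      refine hker Q (fun i j hj => coeff_ofCoeffs_of_notMem q (Or.inr hj)) ?_
      rw [← hzero]
      exact Finset.sum_eq_zero fun i _ => by simp [hall i, liftX]
    refine hne (Prod.ext ?_ ?_)
    · funext i
      exact Subtype.ext (hall i)
    · funext ij
      change q ij = 0
      rw [← coeff_ofCoeffs q ij, ← hQ, hQ0, coeff_zero, coeff_zero]
  have hw : ι w ≠ 0 := (map_ne_zero_iff ι hinj).mpr F.w_ne
  have hN : ι N ≠ 0 := (map_ne_zero_iff ι hinj).mpr F.N_ne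
  refine ⟨n + 1, fun i => if hi : i < n + 2 then (p ⟨i, hi⟩ : K[X]) else 0, ?_, ?_, Q,
    N * w ^ n, mul_ne_zero F.N_ne (pow_ne_zero _ F.w_ne), ?_⟩
  · obtain ⟨i, hi⟩ := hp
    exact ⟨i, by omega, by simpa using hi⟩
  · intro i hi
    simp only [dif_pos (Nat.lt_succ_of_le hi)]
    exact hpdeg _
  · have hQh : ι Q * h / ι (N * w ^ n) = ι Q * H / ι w ^ n := by
      rw [F.h_eq, map_mul, map_pow]
      field_simp
    rw [hQh, derivation_mul_div_pow Dy derivY ι hDyι hw F.Dy_H, ← hzero, map_sum,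
      Finset.sum_mul, Finset.sum_div, Finset.sum_range]
    refine Finset.sum_congr rfl fun i _ => ?_
    simp only [dif_pos i.2, Fin.eta]
    rw [F.iterate_Dx hinj hDxι, map_mul, map_mul, map_pow]
    have hpow : ι w ^ (n + 1) = ι w ^ (n + 1 - (i : ℕ)) * ι w ^ (i : ℕ) := by
      rw [← pow_add]; congr 1; omega
    rw [hpow]
    field_simp

/-- Counting unknowns and equations for a sufficiently large order. -/
lemma card_bound {A γ ε D τ X₀ Y₀ n m k : ℕ} (hD : A * τ + (A + ε) * γ ≤ D)
    (hn : (D + X₀ + 1) * τ + (A + ε) * (Y₀ + 1) ≤ n) (hm : m + ε = D + X₀ + n * A)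
    (hk : Y₀ + (n + 1) * γ + 1 ≤ k + τ) :
    (D + X₀ + (n + 1) * A + 1) * (Y₀ + (n + 1) * γ + 1) < (n + 2) * (D + 1) + (m + 1) * k := by
  zify at *
  have hm' : (m : ℤ) + 1 = D + X₀ + n * A + 1 - ε := by linarith
  have h1 : ((m : ℤ) + 1) * (Y₀ + (n + 1) * γ + 1 - τ) ≤ (m + 1) * k :=
    mul_le_mul_of_nonneg_left (by linarith) (by positivity)
  have h2 : 0 ≤ ((n : ℤ) + 1) * (D - (A * τ + (A + ε) * γ)) :=
    mul_nonneg (by positivity) (by linarith)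
  have h3 : (0 : ℤ) ≤ (A + ε) * τ := by positivity
  rw [hm'] at h1 ⊢
  nlinarith

/-- The space of certificates annihilated by `Dy` is one-dimensional over `K(x)`, so omitting
a single power of `y` always removes it. -/
theorem hasTelescoper [CharZero K] (F : TelescopingForm Dx Dy ι h A γ ε N w u v H)
    (hinj : Function.Injective ι)
    (hDxι : ∀ q : K[X][X], Dx (ι q) = ι (derivative q))
    (hDyι : ∀ q : K[X][X], Dy (ι q) = ι (DY q)) {D : ℕ}
    (hD : A * γ + (A + ε) * γ ≤ D) (hε : ε ≤ D) : HasTelescoper Dx Dy ι h D := by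
  obtain ⟨n, hn⟩ : ∃ n, n = (D + N.natDegree + 1) * γ + (A + ε) * (degY N + 1) := ⟨_, rfl⟩
  obtain ⟨κ, hκ⟩ : ∃ κ, ∀ Q : K[X][X], derivNum derivY w v n Q = 0 → Q ≠ 0 → degY Q = κ := by
    by_cases hQ : ∃ Q, derivNum derivY w v n Q = 0 ∧ Q ≠ 0
    · obtain ⟨Q, hQ, hQ0⟩ := hQ
      refine ⟨degY Q, fun S hS hS0 => degY_eq_of_DY_mul_eq hS0 hQ0 ?_⟩
      simpa only [derivY_apply] using derivNum_wronskian F.w_ne hS hQ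
    · push Not at hQ
      exact ⟨0, fun S hS hS0 => absurd (hQ S hS) hS0⟩
  refine F.hasTelescoper_of_card hinj hDxι hDyι (n := n)
    (m := D + N.natDegree + n * A - ε) (J := (Finset.range (degY N + n * γ + 2)).erase κ)
    ?_ (by omega) ?_ (card_bound hD hn.ge (by omega) ?_)
  · intro j hj
    have := Finset.mem_range.mp (Finset.mem_of_mem_erase hj)
    omega
  · intro Q hQJ hQ
    by_contra hQ0
    have hne : (Bivariate.swap Q).coeff (Bivariate.swap Q).natDegree ≠ 0 := by simpa using hQ0
    refine hne (Polynomial.ext fun i => ?_)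
    rw [coeff_swap, coeff_zero, ← degY_eq_natDegree_swap, hκ Q hQ hQ0]
    exact hQJ i κ (Finset.notMem_erase _ _)
  · have := Finset.pred_card_le_card_erase (s := Finset.range (degY N + n * γ + 2)) (a := κ)
    rw [Finset.card_range] at this
    rw [add_mul]
    omega

/-- Without constants of `Dy` among the certificates of the relevant order, no power of `y`
has to be omitted. -/
theorem hasTelescoper_of_derivNum_injective (F : TelescopingForm Dx Dy ι h A γ ε N w u v H)
    (hinj : Function.Injective ι)
    (hDxι : ∀ q : K[X][X], Dx (ι q) = ι (derivative q))
    (hDyι : ∀ q : K[X][X], Dy (ι q) = ι (DY q)) {D τ : ℕ} (hτ : γ = τ + 1)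
    (hD : A * τ + (A + ε) * γ ≤ D) (hε : ε ≤ D)
    (hker : ∀ n Q, derivNum derivY w v n Q = 0 → Q = 0) : HasTelescoper Dx Dy ι h D := by
  obtain ⟨n, hn⟩ : ∃ n, n = (D + N.natDegree + 1) * τ + (A + ε) * (degY N + 1) := ⟨_, rfl⟩
  refine F.hasTelescoper_of_card hinj hDxι hDyι (n := n)
    (m := D + N.natDegree + n * A - ε) (J := Finset.range (degY N + n * γ + 2))
    ?_ (by omega) (fun Q _ => hker n Q) (card_bound hD hn.ge (by omega) ?_)
  · intro j hj
    have := Finset.mem_range.mp hj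
    omega
  · rw [Finset.card_range, add_mul]
    omega

/-- The constants of `Dy` are stable under `Dx`. -/
lemma derivNum_derivY_derivNum_derivX (F : TelescopingForm Dx Dy ι h A γ ε N w u v H)
    (hinj : Function.Injective ι)
    (hDxι : ∀ q : K[X][X], Dx (ι q) = ι (derivative q))
    (hDyι : ∀ q : K[X][X], Dy (ι q) = ι (DY q)) (hcomm : ∀ g, Dx (Dy g) = Dy (Dx g))
    {n : ℕ} {Q : K[X][X]} (hQ : derivNum derivY w v n Q = 0) :
    derivNum derivY w v (n + 1) (derivNum derivX w u n Q) = 0 := by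
  have hw : ι w ≠ 0 := (map_ne_zero_iff ι hinj).mpr F.w_ne
  have key := hcomm (ι Q * H / ι w ^ n)
  rw [derivation_mul_div_pow Dy derivY ι hDyι hw F.Dy_H, hQ, map_zero, zero_mul, zero_div,
    map_zero, derivation_mul_div_pow Dx derivX ι hDxι hw F.Dx_H,
    derivation_mul_div_pow Dy derivY ι hDyι hw F.Dy_H, eq_comm, div_eq_zero_iff, mul_eq_zero] at key
  rcases key with (key | key) | key
  · exact (map_eq_zero_iff ι hinj).mp key
  · exact absurd key F.H_ne
  · exact absurd key (pow_ne_zero _ hw)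

lemma DY_derivNum_derivX_mul (F : TelescopingForm Dx Dy ι h A γ ε N w u v H)
    (hinj : Function.Injective ι)
    (hDxι : ∀ q : K[X][X], Dx (ι q) = ι (derivative q))
    (hDyι : ∀ q : K[X][X], Dy (ι q) = ι (DY q)) (hcomm : ∀ g, Dx (Dy g) = Dy (Dx g))
    {n : ℕ} {Q : K[X][X]} (hQ : derivNum derivY w v n Q = 0) :
    derivY (derivNum derivX w u n Q) * (Q * w) = derivNum derivX w u n Q * derivY (Q * w) :=
  derivNum_wronskian F.w_ne (F.derivNum_derivY_derivNum_derivX hinj hDxι hDyι hcomm hQ)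
    (by rw [derivNum_mul_self, hQ, mul_zero])

/-- In the presence of a constant of `Dy`, the `y`-degrees are governed by `w` alone. -/
lemma of_constant [CharZero K] (F : TelescopingForm Dx Dy ι h A γ ε N w u v H)
    (hinj : Function.Injective ι)
    (hDxι : ∀ q : K[X][X], Dx (ι q) = ι (derivative q))
    (hDyι : ∀ q : K[X][X], Dy (ι q) = ι (DY q)) (hcomm : ∀ g, Dx (Dy g) = Dy (Dx g))
    {n : ℕ} {Q : K[X][X]} (hQ0 : Q ≠ 0) (hQ : derivNum derivY w v n Q = 0) :
    TelescopingForm Dx Dy ι h A (degY w) ε N w u v H := by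
  refine { F with degY_w := le_rfl, degY_u := ?_, degY_v := ?_ }
  · by_cases hu : u = 0
    · simp [hu]
    have hW := F.DY_derivNum_derivX_mul hinj hDxι hDyι hcomm hQ
    set S := derivNum derivX w u n Q with hS
    have hSdeg : degY S ≤ degY Q + degY w := by
      by_cases hS0 : S = 0
      · simp [hS0]
      · rw [degY_eq_of_DY_mul_eq hS0 (mul_ne_zero hQ0 F.w_ne)
          (by simpa only [derivY_apply] using hW), degY_mul hQ0 F.w_ne]
    have h1 : Q * u = S - (w * derivative Q - n * (Q * derivative w)) := by
      rw [hS]; simp only [derivNum, derivX_apply]; ring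
    have h2 := degY_mul hQ0 hu
    have h3 := degY_sub_le S (w * derivative Q - n * (Q * derivative w))
    have h4 := degY_sub_le (w * derivative Q) (n * (Q * derivative w))
    have h5 := degY_mul_le w (derivative Q)
    have h6 := degY_mul_le (n : K[X][X]) (Q * derivative w)
    have h7 := degY_mul_le Q (derivative w)
    have h8 := degY_derivative_le Q
    have h9 := degY_derivative_le w
    rw [degY_natCast] at h6
    rw [← h1] at h3
    omega
  · by_cases hv : v = 0
    · simp [hv]
    have hCX : (C X : K[X][X]) ≠ 0 := by simp
    have h1 : Q * (C X * v) = (n : K[X][X]) * (Q * (C X * DY w)) - w * (C X * DY Q) := by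
      simp only [derivNum, derivY_apply] at hQ
      linear_combination (C X) * hQ
    have h2 := degY_mul hQ0 (mul_ne_zero hCX hv)
    have h4 := degY_sub_le ((n : K[X][X]) * (Q * (C X * DY w))) (w * (C X * DY Q))
    have h5 := degY_mul_le w (C X * DY Q)
    have h6 := degY_mul_le (n : K[X][X]) (Q * (C X * DY w))
    have h7 := degY_mul_le Q (C X * DY w)
    have h8 := degY_CX_mul_DY_le Q
    have h9 := degY_CX_mul_DY_le w
    rw [degY_natCast] at h6
    rw [← h1] at h4
    omega

/-- In the presence of a constant of `Dy`, the factor `p` of the denominator contributes to both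
logarithmic derivatives of `H` with the same integer multiplicity. -/
lemma exists_int_dvd [CharZero K] (F : TelescopingForm Dx Dy ι h A γ ε N w u v H)
    (hinj : Function.Injective ι)
    (hDxι : ∀ q : K[X][X], Dx (ι q) = ι (derivative q))
    (hDyι : ∀ q : K[X][X], Dy (ι q) = ι (DY q)) (hcomm : ∀ g, Dx (Dy g) = Dy (Dx g))
    {n : ℕ} {Q : K[X][X]} (hQ0 : Q ≠ 0) (hQ : derivNum derivY w v n Q = 0)
    {p w' : K[X][X]} (hp : Prime p) (hpy : 0 < degY p) (hw : w = p * w') :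
    ∃ m : ℤ, p ∣ u - (m : K[X][X]) * (derivative p * w') ∧
      p ∣ v - (m : K[X][X]) * (DY p * w') := by
  have hW := F.DY_derivNum_derivX_mul hinj hDxι hDyι hcomm hQ
  obtain ⟨j, Q₁, hQ₁, rfl⟩ := WfDvdMonoid.max_power_factor hQ0 hp.irreducible
  obtain ⟨k, w₁, hw₁, hwk⟩ := WfDvdMonoid.max_power_factor F.w_ne hp.irreducible
  obtain _ | k := k
  · rw [pow_zero, one_mul] at hwk
    exact absurd ⟨w', hwk ▸ hw⟩ hw₁
  have hw' : w' = p ^ k * w₁ := by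
    refine mul_left_cancel₀ hp.ne_zero ?_
    rw [← hw, hwk]
    ring
  subst hwk hw'
  refine ⟨n * (k + 1) - j, ?_, ?_⟩
  · rw [← derivX_apply]
    refine dvd_of_pow_dvd_derivNum derivX hp hQ₁ ?_
    by_cases hS : derivNum derivX (p ^ (k + 1) * w₁) u n (p ^ j * Q₁) = 0
    · rw [hS]; exact dvd_zero _
    refine pow_dvd_of_wronskian derivY hp (not_dvd_DY hpy) (eq_zero_of_dvd_intCast hpy)
      (T := Q₁ * w₁) _ hS (fun hd => (hp.dvd_or_dvd hd).elim hQ₁ hw₁) ?_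
    have : p ^ (j + (k + 1)) * (Q₁ * w₁) = p ^ j * Q₁ * (p ^ (k + 1) * w₁) := by ring
    rw [this]
    exact hW
  · rw [← derivY_apply]
    refine dvd_of_pow_dvd_derivNum derivY hp hQ₁ ?_
    rw [hQ]
    exact dvd_zero _

/-- Absorb the factor `p ^ m` of `H` into the polynomial part. -/
lemma cancel_prime (F : TelescopingForm Dx Dy ι h A γ ε N w u v H)
    (hinj : Function.Injective ι)
    (hDxι : ∀ q : K[X][X], Dx (ι q) = ι (derivative q))
    (hDyι : ∀ q : K[X][X], Dy (ι q) = ι (DY q))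
    {p w' : K[X][X]} (hpy : 0 < degY p) (hw : w = p * w') {m : ℕ}
    (hu : p ∣ u - (m : K[X][X]) * (derivative p * w'))
    (hv : p ∣ v - (m : K[X][X]) * (DY p * w')) :
    ∃ u' v', TelescopingForm Dx Dy ι h A (γ - 1) ε (N * p ^ m) w' u' v' (H / ι p ^ m) := by
  obtain ⟨u', hu'⟩ := hu
  obtain ⟨v', hv'⟩ := hv
  have hw0 := F.w_ne
  rw [hw] at hw0
  have hp0 := left_ne_zero_of_mul hw0
  have hw'0 := right_ne_zero_of_mul hw0
  have hιp : ι p ≠ 0 := (map_ne_zero_iff ι hinj).mpr hp0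
  have hιpm : ι p ^ m ≠ 0 := pow_ne_zero _ hιp
  have hwx : p.natDegree + w'.natDegree ≤ A := by
    rw [← natDegree_mul hp0 hw'0, ← hw]; exact F.natDegree_w
  have hwy : degY p + degY w' ≤ γ := by
    rw [← degY_mul hp0 hw'0, ← hw]; exact F.degY_w
  have hCX : (C X : K[X][X]) ≠ 0 := by simp
  refine ⟨u', v', ?_, div_ne_zero F.H_ne hιpm, mul_ne_zero F.N_ne (pow_ne_zero _ hp0), hw'0,
    ?_, ?_, by omega, ?_, ?_, by omega, ?_, ?_⟩
  · rw [F.h_eq, map_mul, map_pow]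
    field_simp
  · have hpow := mul_derivation_pow Dx (ι p) m
    have h1 := F.Dx_H
    rw [hDxι] at hpow
    have h2 : ι u = ι p * ι u' + m * (ι (derivative p) * ι w') := by
      rw [sub_eq_iff_eq_add.mp hu']; simp
    rw [hw, map_mul, h2] at h1
    rw [Derivation.leibniz_div]
    simp only [smul_eq_mul]
    field_simp
    refine mul_left_cancel₀ hιp ?_
    linear_combination ι p ^ m * h1 - (H * ι w') * hpow
  · have hpow := mul_derivation_pow Dy (ι p) m
    have h1 := F.Dy_H
    rw [hDyι] at hpow
    have h2 : ι v = ι p * ι v' + m * (ι (DY p) * ι w') := by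
      rw [sub_eq_iff_eq_add.mp hv']; simp
    rw [hw, map_mul, h2] at h1
    rw [Derivation.leibniz_div]
    simp only [smul_eq_mul]
    field_simp
    refine mul_left_cancel₀ hιp ?_
    linear_combination ι p ^ m * h1 - (H * ι w') * hpow
  · by_cases h0 : u' = 0
    · simp [h0]
    have h1 := natDegree_mul hp0 h0
    have h2 : (u - (m : K[X][X]) * (derivative p * w')).natDegree ≤ max A A := by
      refine natDegree_sub_le_of_le F.natDegree_u (natDegree_mul_le.trans ?_)
      have h3 := natDegree_mul_le (p := derivative p) (q := w')
      have h4 := natDegree_derivative_le p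
      rw [natDegree_natCast]
      omega
    rw [hu', max_self] at h2
    omega
  · by_cases h0 : v' = 0
    · simp [h0]
    have h1 := natDegree_mul hp0 h0
    have h2 : (v - (m : K[X][X]) * (DY p * w')).natDegree ≤ max (A + ε) (A + ε) := by
      refine natDegree_sub_le_of_le F.natDegree_v (natDegree_mul_le.trans ?_)
      have h3 := natDegree_mul_le (p := DY p) (q := w')
      have h4 := natDegree_DY_le p
      rw [natDegree_natCast]
      omega
    rw [hv', max_self] at h2
    omega
  · by_cases h0 : u' = 0
    · simp [h0]
    have h1 := degY_mul hp0 h0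
    have h2 := degY_sub_le u ((m : K[X][X]) * (derivative p * w'))
    have h3 := degY_mul_le (m : K[X][X]) (derivative p * w')
    have h4 := degY_mul_le (derivative p) w'
    have h5 := degY_derivative_le p
    have h6 := F.degY_u
    rw [degY_natCast] at h3
    rw [hu'] at h2
    omega
  · by_cases h0 : v' = 0
    · simp [h0]
    have h1 := degY_mul hp0 (mul_ne_zero hCX h0)
    have h2 := degY_sub_le (C X * v) ((m : K[X][X]) * (C X * DY p * w'))
    have h3 := degY_mul_le (m : K[X][X]) (C X * DY p * w')
    have h4 := degY_mul_le (C X * DY p) w'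
    have h5 := degY_CX_mul_DY_le p
    have h6 := F.degY_v
    have h7 : p * (C X * v') = C X * v - (m : K[X][X]) * (C X * DY p * w') := by
      linear_combination (-C X) * hv'
    rw [degY_natCast] at h3
    rw [← h7] at h2
    omega

/-- If the kernel is nontrivial, the generic bound can be improved unless the denominator is
extremal: it has full `y`-degree, no repeated factor, and every factor occurs in `H` with a
negative integer exponent. -/
theorem hasTelescoper_or_extremal [CharZero K]
    (F : TelescopingForm Dx Dy ι h A γ ε N w u v H)
    (hinj : Function.Injective ι)
    (hDxι : ∀ q : K[X][X], Dx (ι q) = ι (derivative q))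
    (hDyι : ∀ q : K[X][X], Dy (ι q) = ι (DY q)) (hcomm : ∀ g, Dx (Dy g) = Dy (Dx g))
    {D τ : ℕ} (hτ : γ = τ + 1) (hD : A * τ + (A + ε) * γ ≤ D) :
    HasTelescoper Dx Dy ι h D ∨ degY w = γ ∧ ∀ p w', Prime p → 0 < degY p → w = p * w' →
      ¬ p ∣ w' ∧ ∃ m : ℤ, m < 0 ∧ p ∣ v - (m : K[X][X]) * (DY p * w') := by
  have hε : ε ≤ D := by rw [hτ] at hD; nlinarith
  by_cases hker : ∀ n Q, derivNum derivY w v n Q = 0 → Q = 0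
  · exact Or.inl (F.hasTelescoper_of_derivNum_injective hinj hDxι hDyι hτ hD hε hker)
  push Not at hker
  obtain ⟨n, Q, hQ, hQ0⟩ := hker
  refine or_iff_not_imp_left.mpr fun hnot => ?_
  have hred {γ' N' w' u' v' H'} (hγ : γ' ≤ τ) :
      ¬ TelescopingForm Dx Dy ι h A γ' ε N' w' u' v' H' := by
    refine fun F' => hnot (F'.hasTelescoper hinj hDxι hDyι ?_ hε)
    rw [hτ] at hD
    nlinarith [Nat.mul_le_mul_left A hγ, Nat.mul_le_mul_left ε hγ]
  refine ⟨?_, fun p w' hp hpy hw => ?_⟩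
  · by_contra hne
    have := F.degY_w
    exact hred (by omega) (F.of_constant hinj hDxι hDyι hcomm hQ0 hQ)
  · obtain ⟨m, hmu, hmv⟩ := F.exists_int_dvd hinj hDxι hDyι hcomm hQ0 hQ hp hpy hw
    have hno (m : ℕ) (hu : p ∣ u - (m : K[X][X]) * (derivative p * w'))
        (hv : p ∣ v - (m : K[X][X]) * (DY p * w')) : False := by
      obtain ⟨u', v', F'⟩ := F.cancel_prime hinj hDxι hDyι hpy hw hu hv
      exact hred (by omega) F'
    refine ⟨fun hpw => hno 0 ?_ ?_, m, ?_, hmv⟩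
    · have : p ∣ (m : K[X][X]) * (derivative p * w') := (hpw.mul_left _).mul_left _
      simpa using (dvd_sub_left this).mp hmu
    · have : p ∣ (m : K[X][X]) * (DY p * w') := (hpw.mul_left _).mul_left _
      simpa using (dvd_sub_left this).mp hmv
    · by_contra! hm
      obtain ⟨m, rfl⟩ := Int.eq_ofNat_of_zero_le hm
      exact hno m (by simpa using hmu) (by simpa using hmv)

end TelescopingForm

section StandardForm

variable {L : ℕ} {a b c0 bs : K[X][X]} {c : Fin L → K[X][X]} {e : Fin L → K}

/-- The numerator of the logarithmic `δ`-derivative of `exp (a / b) * ∏ c ℓ ^ e ℓ` over the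
denominator `b * bs * ∏ c ℓ`, where `b₁ = bs * δ b / b`. -/
noncomputable def logDerivNum (δ : SelfDerivation K[X][X]) (a b bs b₁ : K[X][X])
    (c : Fin L → K[X][X]) (e : Fin L → K) : K[X][X] :=
  (δ a * bs - a * b₁) * (∏ ℓ, c ℓ) +
    b * bs * ∑ ℓ, e ℓ • (δ (c ℓ) * ∏ j ∈ Finset.univ.erase ℓ, c j)

lemma derivation_div_mul_eq_logDerivNum (D : SelfDerivation E) (δ : SelfDerivation K[X][X])
    (ι : K[X][X] →+* E) (hinj : Function.Injective ι) (hι : ∀ q, D (ι q) = ι (δ q))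
    {b₁ : K[X][X]} {h : E} (hb : b ≠ 0) (hc0 : c0 ≠ 0)
    (hb₁ : bs * δ b = b * b₁)
    (hD : D h * ι (c0 * b ^ 2 * (∏ ℓ, c ℓ)) = h * ι (δ c0 * b ^ 2 * (∏ ℓ, c ℓ)
      + (δ a * b - a * δ b) * c0 * (∏ ℓ, c ℓ)
      + c0 * b ^ 2 * ∑ ℓ, e ℓ • (δ (c ℓ) * ∏ j ∈ Finset.univ.erase ℓ, c j))) :
    D (h / ι c0) * ι (b * bs * ∏ ℓ, c ℓ) = h / ι c0 * ι (logDerivNum δ a b bs b₁ c e) := by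
  have hιb : ι b ≠ 0 := (map_ne_zero_iff ι hinj).mpr hb
  have hιc0 : ι c0 ≠ 0 := (map_ne_zero_iff ι hinj).mpr hc0
  have hιb₁ := congrArg ι hb₁
  rw [logDerivNum]
  generalize (∑ ℓ, e ℓ • (δ (c ℓ) * ∏ j ∈ Finset.univ.erase ℓ, c j)) = s at hD ⊢
  generalize (∏ ℓ, c ℓ) = P at hD ⊢
  rw [Derivation.leibniz_div]
  simp only [map_add, map_sub, map_mul, map_pow, smul_eq_mul, hι] at hD hιb₁ ⊢
  field_simp
  refine mul_left_cancel₀ hιb ?_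
  linear_combination ι bs * hD - (h * ι a * ι c0 * ι P) * hιb₁

/-- Degree bound for `logDerivNum`, with respect to either variable according to the choice of
`φ`; here `δ` lowers the degree by at least `s`. -/
lemma natDegree_logDerivNum_le (φ : K[X][X] ≃ₐ[K] K[X][X]) (δ : SelfDerivation K[X][X]) {s : ℕ}
    (hδ : ∀ p, δ p ≠ 0 → (φ (δ p)).natDegree + s ≤ (φ p).natDegree) {b₁ : K[X][X]}
    (hb : b ≠ 0) (hbs : bs ≠ 0) (hc : ∀ ℓ, c ℓ ≠ 0) (hb₁ : bs * δ b = b * b₁) :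
    (φ (logDerivNum δ a b bs b₁ c e)).natDegree ≤
      max ((φ a).natDegree + (φ bs).natDegree + ∑ ℓ, (φ (c ℓ)).natDegree - s)
        ((φ b).natDegree + (φ bs).natDegree + ∑ ℓ, (φ (c ℓ)).natDegree) := by
  have hφ {p : K[X][X]} (hp : p ≠ 0) : φ p ≠ 0 := (map_ne_zero_iff φ φ.injective).mpr hp
  have hprod (t : Finset (Fin L)) : (φ (∏ ℓ ∈ t, c ℓ)).natDegree =
      ∑ ℓ ∈ t, (φ (c ℓ)).natDegree := by
    rw [map_prod, natDegree_prod _ _ fun ℓ _ => hφ (hc ℓ)]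
  have hsplit : φ (logDerivNum δ a b bs b₁ c e) =
      (φ (δ a) * (φ bs * φ (∏ ℓ, c ℓ)) - φ a * (φ b₁ * φ (∏ ℓ, c ℓ))) +
      φ b * (φ bs * ∑ ℓ, e ℓ • (φ (δ (c ℓ)) * φ (∏ j ∈ Finset.univ.erase ℓ, c j))) := by
    simp only [logDerivNum, map_add, map_sub, map_mul, map_sum, map_smul]
    ring
  rw [hsplit]
  refine natDegree_add_le_of_le ((natDegree_sub_le_of_le ?_ ?_).trans (max_self _).le) ?_
  · by_cases h0 : δ a = 0
    · simp [h0]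
    have h1 := natDegree_mul_le (p := φ (δ a)) (q := φ bs * φ (∏ ℓ, c ℓ))
    have h2 := natDegree_mul_le (p := φ bs) (q := φ (∏ ℓ, c ℓ))
    have h3 := hδ a h0
    rw [hprod] at h2
    omega
  · by_cases h0 : b₁ = 0
    · simp [h0]
    have hδb : δ b ≠ 0 := right_ne_zero_of_mul (hb₁ ▸ mul_ne_zero hb h0)
    have h1 := natDegree_mul_le (p := φ a) (q := φ b₁ * φ (∏ ℓ, c ℓ))
    have h2 := natDegree_mul_le (p := φ b₁) (q := φ (∏ ℓ, c ℓ))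
    have h3 := hδ b hδb
    have h4 := congrArg (fun q => (φ q).natDegree) hb₁
    simp only [map_mul] at h4
    rw [natDegree_mul (hφ hbs) (hφ hδb), natDegree_mul (hφ hb) (hφ h0)] at h4
    rw [hprod] at h2
    omega
  · have hsum : (∑ ℓ, e ℓ • (φ (δ (c ℓ)) * φ (∏ j ∈ Finset.univ.erase ℓ, c j))).natDegree ≤
        ∑ ℓ, (φ (c ℓ)).natDegree := by
      refine natDegree_sum_le_of_forall_le _ _ fun ℓ _ => (natDegree_smul_le _ _).trans ?_
      by_cases h0 : δ (c ℓ) = 0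
      · simp [h0]
      have h1 := natDegree_mul_le (p := φ (δ (c ℓ))) (q := φ (∏ j ∈ Finset.univ.erase ℓ, c j))
      have h2 := hδ _ h0
      have h3 := Finset.add_sum_erase Finset.univ (fun j => (φ (c j)).natDegree)
        (Finset.mem_univ ℓ)
      rw [hprod] at h1
      omega
    have h1 := natDegree_mul_le (p := φ b)
      (q := φ bs * ∑ ℓ, e ℓ • (φ (δ (c ℓ)) * φ (∏ j ∈ Finset.univ.erase ℓ, c j)))
    have h2 := natDegree_mul_le (p := φ bs)
      (q := ∑ ℓ, e ℓ • (φ (δ (c ℓ)) * φ (∏ j ∈ Finset.univ.erase ℓ, c j)))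
    omega

lemma C_X_mul_logDerivNum (δ : SelfDerivation K[X][X]) (b₁ : K[X][X]) :
    C X * logDerivNum δ a b bs b₁ c e =
      logDerivNum ((C X : K[X][X]) • δ) a b bs (C X * b₁) c e := by
  simp only [logDerivNum, Derivation.smul_apply, smul_eq_mul, mul_assoc, ← mul_smul_comm,
    ← Finset.mul_sum]
  ring

/-- A hyperexponential term in standard form admits a telescoping form. -/
theorem telescopingForm_standardForm {Dx Dy : SelfDerivation E}
    {ι : K[X][X] →+* E} (hinj : Function.Injective ι)
    (hDxι : ∀ q : K[X][X], Dx (ι q) = ι (derivative q))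
    (hDyι : ∀ q : K[X][X], Dy (ι q) = ι (DY q))
    (hb : b ≠ 0) (hc0 : c0 ≠ 0) (hc : ∀ ℓ, c ℓ ≠ 0) (hbs : bs ≠ 0) {h : E} (hh : h ≠ 0)
    {b₁ b₂ : K[X][X]} (hb₁ : bs * derivX b = b * b₁) (hb₂ : bs * derivY b = b * b₂)
    (hDxh : Dx h * ι (c0 * b ^ 2 * (∏ ℓ, c ℓ)) = h * ι (derivative c0 * b ^ 2 * (∏ ℓ, c ℓ)
      + (derivative a * b - a * derivative b) * c0 * (∏ ℓ, c ℓ)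
      + c0 * b ^ 2 * ∑ ℓ, e ℓ • (derivative (c ℓ) * ∏ j ∈ Finset.univ.erase ℓ, c j)))
    (hDyh : Dy h * ι (c0 * b ^ 2 * (∏ ℓ, c ℓ)) = h * ι (DY c0 * b ^ 2 * (∏ ℓ, c ℓ)
      + (DY a * b - a * DY b) * c0 * (∏ ℓ, c ℓ)
      + c0 * b ^ 2 * ∑ ℓ, e ℓ • (DY (c ℓ) * ∏ j ∈ Finset.univ.erase ℓ, c j)))
    {A ε : ℕ} (hA : b.natDegree + bs.natDegree + ∑ ℓ, (c ℓ).natDegree ≤ A)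
    (hA' : a.natDegree + bs.natDegree + ∑ ℓ, (c ℓ).natDegree ≤ A + ε) (hε : ε ≤ 1) :
    TelescopingForm Dx Dy ι h A (degY bs + max (degY a) (degY b) + ∑ ℓ, degY (c ℓ)) ε c0
      (b * bs * ∏ ℓ, c ℓ) (logDerivNum derivX a b bs b₁ c e) (logDerivNum derivY a b bs b₂ c e)
      (h / ι c0) := by
  have hιc0 : ι c0 ≠ 0 := (map_ne_zero_iff ι hinj).mpr hc0
  have hP : ∏ ℓ, c ℓ ≠ 0 := Finset.prod_ne_zero_iff.mpr fun ℓ _ => hc ℓ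
  refine ⟨by field_simp, div_ne_zero hh hιc0, hc0, mul_ne_zero (mul_ne_zero hb hbs) hP,
    derivation_div_mul_eq_logDerivNum Dx derivX ι hinj hDxι hb hc0 hb₁ hDxh,
    derivation_div_mul_eq_logDerivNum Dy derivY ι hinj hDyι hb hc0 hb₂ hDyh, ?_, ?_, ?_, ?_,
    ?_, ?_⟩
  · rwa [natDegree_mul (mul_ne_zero hb hbs) hP, natDegree_mul hb hbs,
      natDegree_prod _ _ fun ℓ _ => hc ℓ]
  · have hδ (p : K[X][X]) (hp : derivX p ≠ 0) : (derivX p).natDegree + 1 ≤ p.natDegree := by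
      refine natDegree_derivative_lt fun h0 => hp ?_
      rw [derivX_apply, natDegree_eq_zero.mp h0 |>.choose_spec.symm, derivative_C]
    have := natDegree_logDerivNum_le (a := a) (e := e) AlgEquiv.refl derivX hδ hb hbs hc hb₁
    simp only [AlgEquiv.coe_refl, id_eq] at this
    omega
  · have := natDegree_logDerivNum_le (a := a) (e := e) (s := 0) AlgEquiv.refl derivY
      (fun p _ => natDegree_DY_le p) hb hbs hc hb₂
    simp only [AlgEquiv.coe_refl, id_eq] at this
    omega
  · rw [degY_mul (mul_ne_zero hb hbs) hP, degY_mul hb hbs, degY_prod _ _ fun ℓ _ => hc ℓ]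
    omega
  · have := natDegree_logDerivNum_le (a := a) (e := e) (s := 0) Bivariate.swap derivX
      (fun p _ => by
        simpa only [add_zero, ← degY_eq_natDegree_swap, derivX_apply] using degY_derivative_le p)
      hb hbs hc hb₁
    simp only [← degY_eq_natDegree_swap] at this
    omega
  · have := natDegree_logDerivNum_le (a := a) (e := e) (s := 0) Bivariate.swap
      ((C X : K[X][X]) • derivY) (b₁ := C X * b₂)
      (fun p _ => by
        simpa only [add_zero, ← degY_eq_natDegree_swap, Derivation.smul_apply, smul_eq_mul,
          derivY_apply] using degY_CX_mul_DY_le p)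
      hb hbs hc (by
        rw [Derivation.smul_apply, smul_eq_mul]
        linear_combination (C X) * hb₂)
    simp only [← degY_eq_natDegree_swap, ← C_X_mul_logDerivNum] at this
    omega

/-- Modulo a factor `p` of `c ℓ`, only the `ℓ`-th summand of the numerator survives. -/
lemma dvd_logDerivNum_sub (δ : SelfDerivation K[X][X]) (b₁ : K[X][X]) {ℓ : Fin L}
    {p c' : K[X][X]} (hcℓ : c ℓ = p * c') :
    p ∣ logDerivNum δ a b bs b₁ c e -
      e ℓ • (δ p * (b * bs * (c' * ∏ j ∈ Finset.univ.erase ℓ, c j))) := by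
  have hpc : p ∣ c ℓ := ⟨c', hcℓ⟩
  have hrest : p ∣ ∑ i ∈ Finset.univ.erase ℓ,
      e i • (δ (c i) * ∏ j ∈ Finset.univ.erase i, c j) := by
    refine Finset.dvd_sum fun i hi => dvd_smul_of_dvd _ (Dvd.dvd.mul_left ?_ _)
    exact hpc.trans (Finset.dvd_prod_of_mem _
      (Finset.mem_erase.mpr ⟨(Finset.ne_of_mem_erase hi).symm, Finset.mem_univ _⟩))
  have hP : p ∣ ∏ j, c j := hpc.trans (Finset.dvd_prod_of_mem _ (Finset.mem_univ _))
  have hsplit : logDerivNum δ a b bs b₁ c e -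
      e ℓ • (δ p * (b * bs * (c' * ∏ j ∈ Finset.univ.erase ℓ, c j))) =
      (δ a * bs - a * b₁) * (∏ ℓ, c ℓ) + b * bs * (∑ i ∈ Finset.univ.erase ℓ,
        e i • (δ (c i) * ∏ j ∈ Finset.univ.erase i, c j)) +
      p * (e ℓ • (b * bs * (δ c' * ∏ j ∈ Finset.univ.erase ℓ, c j))) := by
    rw [logDerivNum, ← Finset.add_sum_erase Finset.univ _ (Finset.mem_univ ℓ), hcℓ,
      Derivation.leibniz]
    simp only [smul_eq_mul, Algebra.smul_def]
    ring
  rw [hsplit]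
  exact dvd_add (dvd_add (hP.mul_left _) (hrest.mul_left _)) (dvd_mul_right _ _)

/-- In the extremal case, `exp (a / b) * ∏ c ℓ ^ e ℓ` is, up to a factor free of `y`, the
reciprocal of a polynomial. -/
theorem rational_of_extremal [CharZero K] (hb : b ≠ 0) (hbs : bs ≠ 0) (hc : ∀ ℓ, c ℓ ≠ 0)
    (hbsb : ∀ q, Prime q → q ∣ b → q ∣ bs) {b₂ : K[X][X]}
    (hdeg : degY (b * bs * ∏ ℓ, c ℓ) = degY bs + max (degY a) (degY b) + ∑ ℓ, degY (c ℓ))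
    (hext : ∀ p w', Prime p → 0 < degY p → b * bs * ∏ ℓ, c ℓ = p * w' → ¬ p ∣ w' ∧
      ∃ m : ℤ, m < 0 ∧
        p ∣ logDerivNum derivY a b bs b₂ c e - (m : K[X][X]) * (DY p * w')) :
    (∃ a' b' : K[X], b' ≠ 0 ∧ a * liftX b' = b * liftX a') ∧
      (∀ ℓ, degY (c ℓ) = 0 ∨ ∃ n : ℤ, e ℓ = (n : K)) ∧
      (∃ η : ℤ, (η : K) = ∑ ℓ, e ℓ * (degY (c ℓ) : K) ∧ η ≤ (degY c0 : ℤ)) := by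
  have hP : ∏ ℓ, c ℓ ≠ 0 := Finset.prod_ne_zero_iff.mpr fun ℓ _ => hc ℓ
  rw [degY_mul (mul_ne_zero hb hbs) hP, degY_mul hb hbs, degY_prod _ _ fun ℓ _ => hc ℓ] at hdeg
  have hdegb : degY b = 0 := by
    by_contra hne
    obtain ⟨p, hp, hpb, hpy⟩ := exists_prime_dvd_degY_pos (Nat.pos_of_ne_zero hne)
    have hpbs := hbsb p hp hpb
    obtain ⟨b', rfl⟩ := hpb
    refine (hext p (b' * bs * ∏ ℓ, c ℓ) hp hpy (by ring)).1 ?_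
    exact (hpbs.mul_left _).mul_right _
  have hdega : degY a = 0 := by omega
  obtain ⟨a', ha'⟩ := exists_eq_liftX hdega
  obtain ⟨b', hb'⟩ := exists_eq_liftX hdegb
  have hexp (ℓ) (hℓ : degY (c ℓ) ≠ 0) : ∃ m : ℤ, m < 0 ∧ e ℓ = (m : K) := by
    obtain ⟨p, hp, ⟨c', hc'⟩, hpy⟩ := exists_prime_dvd_degY_pos (Nat.pos_of_ne_zero hℓ)
    obtain ⟨hnot, m, hm, hdvd⟩ := hext p (b * bs * (c' * ∏ j ∈ Finset.univ.erase ℓ, c j)) hp hpy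
      (by rw [← Finset.mul_prod_erase Finset.univ c (Finset.mem_univ ℓ), hc']; ring)
    refine ⟨m, hm, ?_⟩
    by_contra hne
    have hd := dvd_sub hdvd
      (dvd_logDerivNum_sub (a := a) (b := b) (bs := bs) (e := e) derivY b₂ hc')
    rw [derivY_apply] at hd
    generalize b * bs * (c' * ∏ j ∈ Finset.univ.erase ℓ, c j) = w' at hd hnot
    have hz : e ℓ - (m : K) ≠ 0 := sub_ne_zero.mpr hne
    have heq : logDerivNum derivY a b bs b₂ c e - (m : K[X][X]) * (DY p * w') -
        (logDerivNum derivY a b bs b₂ c e - e ℓ • (DY p * w')) =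
        (e ℓ - (m : K)) • (DY p * w') := by
      rw [sub_smul, Int.cast_smul_eq_zsmul, zsmul_eq_mul]
      ring
    rw [heq] at hd
    have hd' := dvd_smul_of_dvd (e ℓ - (m : K))⁻¹ hd
    rw [inv_smul_smul₀ hz] at hd'
    exact (hp.dvd_or_dvd hd').elim (not_dvd_DY hpy) hnot
  refine ⟨⟨a', b', ?_, ?_⟩, fun ℓ => ?_, ?_⟩
  · rintro rfl
    exact hb (by simpa [liftX] using hb')
  · rw [← ha', ← hb', mul_comm]
  · exact or_iff_not_imp_left.mpr fun hℓ => (hexp ℓ hℓ).imp fun _ hm => hm.2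
  · have hall (ℓ) : ∃ m : ℤ, m ≤ 0 ∧ e ℓ * (degY (c ℓ) : K) = (m : K) := by
      by_cases hℓ : degY (c ℓ) = 0
      · exact ⟨0, le_rfl, by simp [hℓ]⟩
      · obtain ⟨m, hm, hem⟩ := hexp ℓ hℓ
        exact ⟨m * degY (c ℓ), mul_nonpos_of_nonpos_of_nonneg hm.le (by positivity),
          by simp [hem]⟩
    choose m hm hem using hall
    refine ⟨∑ ℓ, m ℓ, by simp [hem], ?_⟩
    exact (Finset.sum_nonpos fun ℓ _ => hm ℓ).trans (by positivity)

end StandardForm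

end Telescoping

/-- An additive map satisfying the Leibniz rule, as a derivation. -/
def derivationOfLeibniz {E : Type*} [Field E] (D : E → E) (hadd : ∀ u v, D (u + v) = D u + D v)
    (hmul : ∀ u v, D (u * v) = D u * v + u * D v) : SelfDerivation E :=
  Derivation.mk' (AddMonoidHom.mk' D hadd).toIntLinearMap fun f g => by
    have := hmul f g
    simp only [AddMonoidHom.coe_toIntLinearMap, AddMonoidHom.mk'_apply, smul_eq_mul]
    rw [this]
    ring

theorem minimal_degree_bound
    {K : Type*} {E : Type*} [Field K] [CharZero K] [Field E]
    (Dx Dy : E → E)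
    (hDxadd : ∀ u v : E, Dx (u + v) = Dx u + Dx v)
    (hDxmul : ∀ u v : E, Dx (u * v) = Dx u * v + u * Dx v)
    (hDyadd : ∀ u v : E, Dy (u + v) = Dy u + Dy v)
    (hDymul : ∀ u v : E, Dy (u * v) = Dy u * v + u * Dy v)
    (hcomm : ∀ u : E, Dx (Dy u) = Dy (Dx u))
    (ι : Polynomial (Polynomial K) →+* E)
    (hinj : Function.Injective ι)
    (hDxι : ∀ q : Polynomial (Polynomial K), Dx (ι q) = ι (Polynomial.derivative q))
    (hDyι : ∀ q : Polynomial (Polynomial K), Dy (ι q) = ι (DY q))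
    (L : ℕ) (a b c0 bs : Polynomial (Polynomial K))
    (c : Fin L → Polynomial (Polynomial K)) (e : Fin L → K)
    (ha : a ≠ 0) (hb : b ≠ 0) (hc0 : c0 ≠ 0) (hc : ∀ ℓ, c ℓ ≠ 0)
    (hbs : Squarefree bs)
    (hbsb : ∀ q : Polynomial (Polynomial K), Prime q → (q ∣ bs ↔ q ∣ b))
    (h : E) (hh : h ≠ 0)
    (hDxh : Dx h * ι (c0 * b ^ 2 * (∏ ℓ, c ℓ))
      = h * ι (Polynomial.derivative c0 * b ^ 2 * (∏ ℓ, c ℓ)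
          + (Polynomial.derivative a * b - a * Polynomial.derivative b) * c0 * (∏ ℓ, c ℓ)
          + c0 * b ^ 2 * ∑ ℓ, e ℓ • (Polynomial.derivative (c ℓ) * ∏ j ∈ Finset.univ.erase ℓ, c j)))
    (hDyh : Dy h * ι (c0 * b ^ 2 * (∏ ℓ, c ℓ))
      = h * ι (DY c0 * b ^ 2 * (∏ ℓ, c ℓ)
          + (DY a * b - a * DY b) * c0 * (∏ ℓ, c ℓ)
          + c0 * b ^ 2 * ∑ ℓ, e ℓ • (DY (c ℓ) * ∏ j ∈ Finset.univ.erase ℓ, c j)))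
    (hce : ∀ ℓ, e ℓ ≠ 0)
    (hndx : 0 < max a.natDegree b.natDegree + ∑ ℓ, (c ℓ).natDegree)
    (hndy : 0 < max (degY a) (degY b) + ∑ ℓ, degY (c ℓ))
    (φ3 : ℕ) (hφ3a : φ3 ≤ 1)
    (hφ3 : φ3 = 1 ↔
      ((∃ a' b' : Polynomial K, b' ≠ 0 ∧ a * liftX b' = b * liftX a') ∧
       (∀ ℓ, degY (c ℓ) = 0 ∨ ∃ n : ℤ, e ℓ = (n : K)) ∧
       (∃ η : ℤ, (η : K) = ∑ ℓ, e ℓ * (degY (c ℓ) : K) ∧ η ≤ (degY c0 : ℤ))))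
 :
    ∃ r : ℕ, ∃ p : ℕ → Polynomial K,
      (∃ i ≤ r, p i ≠ 0) ∧
      (∀ i ≤ r, ((p i).natDegree : ℤ) ≤ (if b.natDegree < a.natDegree
      then (((bs.natDegree : ℤ) + (b.natDegree : ℤ) + ∑ ℓ, ((c ℓ).natDegree : ℤ)) + ((a.natDegree : ℤ) - (b.natDegree : ℤ) - 1)) * (2 * ((degY bs + max (degY a) (degY b) + ∑ ℓ, degY (c ℓ)) : ℤ) - 1 + (φ3 : ℤ))
            + ((degY bs + max (degY a) (degY b) + ∑ ℓ, degY (c ℓ)) : ℤ)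
      else ((bs.natDegree : ℤ) + (b.natDegree : ℤ) + ∑ ℓ, ((c ℓ).natDegree : ℤ)) * (2 * ((degY bs + max (degY a) (degY b) + ∑ ℓ, degY (c ℓ)) : ℤ) - 1 + (φ3 : ℤ)))) ∧
      ∃ u v : Polynomial (Polynomial K), v ≠ 0 ∧
        ∑ i ∈ Finset.range (r + 1), ι (liftX (p i)) * Dx^[i] h
          = Dy (ι u * h / ι v) := by
  let Dx' := derivationOfLeibniz Dx hDxadd hDxmul
  let Dy' := derivationOfLeibniz Dy hDyadd hDymul
  have hbs0 : bs ≠ 0 := hbs.ne_zero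
  obtain ⟨b₁, hb₁⟩ := dvd_mul_derivation derivX hb fun q hq => (hbsb q hq).mpr
  obtain ⟨b₂, hb₂⟩ := dvd_mul_derivation derivY hb fun q hq => (hbsb q hq).mpr
  obtain ⟨γ, hγ⟩ : ∃ γ, degY bs + max (degY a) (degY b) + ∑ ℓ, degY (c ℓ) = γ := ⟨_, rfl⟩
  obtain ⟨τ, hτ⟩ : ∃ τ, γ = τ + 1 := ⟨γ - 1, by omega⟩
  suffices hmain : ∀ A ε : ℕ, b.natDegree + bs.natDegree + ∑ ℓ, (c ℓ).natDegree ≤ A →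
      a.natDegree + bs.natDegree + ∑ ℓ, (c ℓ).natDegree ≤ A + ε → ε ≤ 1 →
      HasTelescoper Dx Dy ι h (A * (2 * τ + 1 + φ3) + ε * γ) by
    have hγ' : ((degY bs + max (degY a) (degY b) + ∑ ℓ, degY (c ℓ)) : ℤ) = τ + 1 := by
      exact_mod_cast hγ.trans hτ
    rw [hγ']
    split_ifs with hab
    · obtain ⟨r, p, hp, hpd, hrel⟩ := hmain
        (a.natDegree - 1 + bs.natDegree + ∑ ℓ, (c ℓ).natDegree) 1 (by omega) (by omega) le_rfl
      refine ⟨r, p, hp, fun i hi => ?_, hrel⟩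
      have := hpd i hi
      have ha1 : 1 ≤ a.natDegree := by omega
      zify [ha1] at this
      refine this.trans (le_of_eq ?_)
      rw [hτ]
      push_cast
      ring
    · obtain ⟨r, p, hp, hpd, hrel⟩ := hmain
        (b.natDegree + bs.natDegree + ∑ ℓ, (c ℓ).natDegree) 0 le_rfl (by omega) zero_le_one
      refine ⟨r, p, hp, fun i hi => ?_, hrel⟩
      have := hpd i hi
      zify at this
      refine this.trans (le_of_eq ?_)
      ring
  intro A ε hA hA' hε
  have F := telescopingForm_standardForm (Dx := Dx') (Dy := Dy') hinj hDxι hDyι hb hc0 hc hbs0 hh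
    hb₁ hb₂ hDxh hDyh hA hA' hε
  rw [hγ] at F
  change HasTelescoper Dx' Dy' ι h _
  obtain rfl | rfl : φ3 = 0 ∨ φ3 = 1 := by omega
  · refine (F.hasTelescoper_or_extremal hinj hDxι hDyι hcomm hτ ?_).resolve_right ?_
    · rw [hτ]
      apply le_of_eq
      ring
    · rintro ⟨hdeg, hext⟩
      exact absurd (hφ3.mpr (rational_of_extremal hb hbs0 hc (fun q hq => (hbsb q hq).mpr)
        (hdeg.trans hγ.symm) hext)) zero_ne_one
  · refine F.hasTelescoper hinj hDxι hDyι ?_ ?_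
    · rw [hτ]
      apply le_of_eq
      ring
    · rw [hτ]
      nlinarith
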